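/- If a convex function u : ℝⁿ → ℝ vanishes along the first coordinate axis, i.e. u(t, 0, …, 0) = 0 for all t ∈ ℝ, then u is independent of its first coordinate: u(x₁, x₂, …, xₙ) = u(0, x₂, …, xₙ) for every x = (x₁, …, xₙ) ∈ ℝⁿ. -/

import Mathlib

theorem splitting_aux {n : ℕ} (u : (Fin (n + 1) → ℝ) → ℝ)
    (hu : ConvexOn ℝ Set.univ u)
    (hline : ∀ t : ℝ, u (Pi.single 0 t) = 0) (x : Fin (n + 1) → ℝ) (s : ℝ) :
    u (x + Pi.single 0 s) ≤ u x := by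
  have hb : ∀ r : ℝ, u (x + Pi.single 0 r) ≤ (1 / 2) * u ((2 : ℝ) • x) := by
    intro r
    have h := hu.2 (Set.mem_univ ((2 : ℝ) • x)) (Set.mem_univ (Pi.single 0 (2 * r)))
      (show (0 : ℝ) ≤ 1 / 2 by norm_num) (show (0 : ℝ) ≤ 1 / 2 by norm_num) (by norm_num)
    have e : (1 / 2 : ℝ) • ((2 : ℝ) • x) + (1 / 2 : ℝ) • (Pi.single 0 (2 * r))
        = x + Pi.single 0 r := by
      rw [smul_smul, ← Pi.single_smul]
      norm_num
      ring
    rw [e, hline] at h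
    simpa using h
  by_contra! hlt
  set M := (1 / 2) * u ((2 : ℝ) • x)
  set d := u (x + Pi.single 0 s) - u x with hd
  have hdpos : 0 < d := by linarith
  have hC := abs_nonneg (M - u x)
  have hC' := le_abs_self (M - u x)
  set C := |M - u x|
  have hpos : 0 < d + C := by linarith
  set ε := d / (d + C) with hε
  have hε0 : 0 < ε := div_pos hdpos hpos
  have hε1 : ε ≤ 1 := by rw [hε, div_le_one hpos]; linarith
  have hεm : ε * (d + C) = d := div_mul_cancel₀ _ hpos.ne'
  have h := hu.2 (Set.mem_univ x) (Set.mem_univ (x + Pi.single 0 (s / ε)))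
    (show (0 : ℝ) ≤ 1 - ε by linarith) hε0.le (by ring)
  have e : (1 - ε) • x + ε • (x + Pi.single 0 (s / ε)) = x + Pi.single 0 s := by
    rw [smul_add, ← Pi.single_smul, smul_eq_mul, mul_div_cancel₀ _ hε0.ne', ← add_assoc,
      ← add_smul]
    simp
  rw [e] at h
  simp only [smul_eq_mul] at h
  have h1 := mul_le_mul_of_nonneg_left (hb (s / ε)) hε0.le
  have h2 := mul_le_mul_of_nonneg_left hC' hε0.le
  have h3 := mul_pos hε0 hdpos
  linarith

/-- **Splitting of convex functions.** If a convex function `u : ℝⁿ → ℝ` vanishes along the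
first coordinate axis, then it is independent of its first coordinate. -/
theorem convex_function_splitting {n : ℕ} (u : (Fin (n + 1) → ℝ) → ℝ)
    (hu : ConvexOn ℝ Set.univ u)
    (hline : ∀ t : ℝ, u (Pi.single 0 t) = 0) :
    ∀ x : Fin (n + 1) → ℝ, u x = u (Function.update x 0 0) := by
  intro x
  have e : Function.update x 0 0 + Pi.single 0 (x 0) = x := by
    ext i
    by_cases hi : i = 0
    · subst hi; simp
    · simp [hi]
  have e2 : x + Pi.single 0 (-x 0) = Function.update x 0 0 := by
    ext i
    by_cases hi : i = 0
    · subst hi; simp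
    · simp [hi]
  apply le_antisymm
  · have h := splitting_aux u hu hline (Function.update x 0 0) (x 0)
    rwa [e] at h
  · have h := splitting_aux u hu hline x (-x 0)
    rwa [e2] at h
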